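/- arXiv:2009.00241 — 2 statements merged into one kernel-verified Lean document; each statement's English description precedes it below -/
import Mathlib

section
/- Let f : (0,∞) → ℝ admit the representation f(t) = a + b·t + ∫₀^∞ (tλ)/(t+λ) dw(λ) for all t > 0, where a ∈ ℝ, b ≥ 0 and w is a positive measure on (0,∞) with ∫₀^∞ λ/(1+λ) dw(λ) < ∞. If A, B, P are strictly positive operators on a complex Hilbert space H with B ≥ A, then 𝒫_f(P,B) − 𝒫_f(P,A) ≥ a(B − A). -/
open MeasureTheory

variable {H : Type*} [NormedAddCommGroup H] [InnerProductSpace ℂ H] [CompleteSpace H]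

/-- An operator `T` on a complex Hilbert space is *strictly positive* if
`⟪T x, x⟫ ≥ 0` for all `x` and `T` is invertible. -/
def StrictlyPos (T : H →L[ℂ] H) : Prop := T.IsPositive ∧ IsUnit T

/-- `A^{1/2}` via the continuous functional calculus. -/
noncomputable def opSqrt (A : H →L[ℂ] H) : H →L[ℂ] H := cfc Real.sqrt A

/-- `A^{-1/2}` via the continuous functional calculus. -/
noncomputable def opInvSqrt (A : H →L[ℂ] H) : H →L[ℂ] H :=
  cfc (fun x : ℝ => (Real.sqrt x)⁻¹) A

/-- The noncommutative perspective `𝒫_f(B, A) := A^{1/2} f(A^{-1/2} B A^{-1/2}) A^{1/2}`. -/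
noncomputable def persp (f : ℝ → ℝ) (B A : H →L[ℂ] H) : H →L[ℂ] H :=
  opSqrt A * cfc f (opInvSqrt A * B * opInvSqrt A) * opSqrt A

/-- The weighted operator geometric mean `A ♯_ν B := A^{1/2} (A^{-1/2} B A^{-1/2})^ν A^{1/2}`. -/
noncomputable def gmean (ν : ℝ) (A B : H →L[ℂ] H) : H →L[ℂ] H :=
  opSqrt A * cfc (fun x : ℝ => x ^ ν) (opInvSqrt A * B * opInvSqrt A) * opSqrt A

/-- The relative operator entropy `S(A|B) := A^{1/2} ln(A^{-1/2} B A^{-1/2}) A^{1/2}`. -/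
noncomputable def relEntropy (A B : H →L[ℂ] H) : H →L[ℂ] H :=
  opSqrt A * cfc Real.log (opInvSqrt A * B * opInvSqrt A) * opSqrt A

theorem StrictlyPos.isStrictlyPositive {T : H →L[ℂ] H} (hT : StrictlyPos T) :
    IsStrictlyPositive T :=
  ⟨(ContinuousLinearMap.nonneg_iff_isPositive T).mpr hT.1, hT.2⟩

theorem spectrum_real_pos {T : H →L[ℂ] H} (hT : IsStrictlyPositive T) :
    ∀ t ∈ spectrum ℝ T, 0 < t := fun _ ht => hT.spectrum_pos ht

theorem opInvSqrt_isSelfAdjoint (A : H →L[ℂ] H) : IsSelfAdjoint (opInvSqrt A) :=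
  cfc_predicate _ A

theorem opSqrt_mul_self {A : H →L[ℂ] H} (hA : IsStrictlyPositive A) :
    opSqrt A * opSqrt A = A := by
  have hs := spectrum_real_pos hA
  have : IsSelfAdjoint A := hA.nonneg.isSelfAdjoint
  unfold opSqrt
  rw [← cfc_mul _ _ A, cfc_congr (g := fun t => t) fun t ht => Real.mul_self_sqrt (hs t ht).le,
    cfc_id' ℝ A]

theorem continuousOn_inv_sqrt {A : H →L[ℂ] H} (hA : IsStrictlyPositive A) :
    ContinuousOn (fun t : ℝ => (Real.sqrt t)⁻¹) (spectrum ℝ A) :=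
  Real.continuous_sqrt.continuousOn.inv₀ fun t ht =>
    (Real.sqrt_pos.mpr (spectrum_real_pos hA t ht)).ne'

theorem opSqrt_mul_opInvSqrt {A : H →L[ℂ] H} (hA : IsStrictlyPositive A) :
    opSqrt A * opInvSqrt A = 1 := by
  have hs := spectrum_real_pos hA
  have : IsSelfAdjoint A := hA.nonneg.isSelfAdjoint
  unfold opSqrt opInvSqrt
  rw [← cfc_mul _ _ A (by fun_prop) (continuousOn_inv_sqrt hA),
    cfc_congr (g := fun _ => 1) fun t ht =>
      mul_inv_cancel₀ (Real.sqrt_pos.mpr (hs t ht)).ne', cfc_const_one ℝ A]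

theorem opInvSqrt_mul_opSqrt {A : H →L[ℂ] H} (hA : IsStrictlyPositive A) :
    opInvSqrt A * opSqrt A = 1 := by
  rw [← opSqrt_mul_opInvSqrt hA]
  exact (cfc_commute_cfc _ _ A).eq

theorem isStrictlyPositive_conj {A P : H →L[ℂ] H} (hA : IsStrictlyPositive A)
    (hP : IsStrictlyPositive P) : IsStrictlyPositive (opInvSqrt A * P * opInvSqrt A) := by
  have hu : IsUnit (opInvSqrt A) :=
    ⟨⟨_, _, opInvSqrt_mul_opSqrt hA, opSqrt_mul_opInvSqrt hA⟩, rfl⟩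
  exact ⟨(opInvSqrt_isSelfAdjoint A).conjugate_nonneg hP.nonneg, (hu.mul hP.isUnit).mul hu⟩

theorem opSqrt_conj_cancel {A : H →L[ℂ] H} (hA : IsStrictlyPositive A) (P : H →L[ℂ] H) :
    opSqrt A * (opInvSqrt A * P * opInvSqrt A) * opSqrt A = P := by
  calc _ = (opSqrt A * opInvSqrt A) * P * (opInvSqrt A * opSqrt A) := by noncomm_ring
    _ = P := by rw [opSqrt_mul_opInvSqrt hA, opInvSqrt_mul_opSqrt hA]; simp

open Ring in
/-- The perspective of `t ↦ tl/(t+l)` is a multiple of a parallel sum. -/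
theorem persp_mul_div_add_eq {A P : H →L[ℂ] H} (hA : IsStrictlyPositive A)
    (hP : IsStrictlyPositive P) {l : ℝ} (hl : 0 < l) :
    persp (fun t => t * l / (t + l)) P A = l • (A⁻¹ʳ + l • P⁻¹ʳ)⁻¹ʳ := by
  set R := opInvSqrt A
  set S := opSqrt A
  set X := R * P * R with hX
  have hSR : S * R = 1 := opSqrt_mul_opInvSqrt hA
  have hRS : R * S = 1 := opInvSqrt_mul_opSqrt hA
  have hSS : S * S = A := opSqrt_mul_self hA
  have hXp : IsStrictlyPositive X := isStrictlyPositive_conj hA hP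
  have hs := spectrum_real_pos hXp
  have hsa : IsSelfAdjoint X := hXp.nonneg.isSelfAdjoint
  have hPP : P * P⁻¹ʳ = 1 := Ring.mul_inverse_cancel _ hP.isUnit
  have hAi : A⁻¹ʳ = R * R := by
    have h1 : A⁻¹ʳ * A = 1 := Ring.inverse_mul_cancel _ hA.isUnit
    have h2 : A * (R * R) = 1 := by
      calc A * (R * R) = S * (S * R) * R := by rw [← hSS]; noncomm_ring
        _ = 1 := by rw [hSR, mul_one, hSR]
    exact left_inv_eq_right_inv h1 h2
  have hc : ContinuousOn (fun t : ℝ => t * l / (t + l)) (spectrum ℝ X) :=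
    ContinuousOn.div (by fun_prop) (by fun_prop) fun t ht => by
      have := hs t ht; positivity
  set Y := cfc (fun t : ℝ => t * l / (t + l)) X with hY
  have hYX : Y * (X + l • 1) = l • X := by
    have h1 : X + l • 1 = cfc (fun t : ℝ => t + l) X := by
      rw [cfc_add_const l (fun t => t) X, cfc_id' ℝ X, Algebra.algebraMap_eq_smul_one]
    have h2 : l • X = cfc (fun t : ℝ => l * t) X := by
      rw [cfc_const_mul_id l X]
    rw [h1, h2, hY, ← cfc_mul _ _ X hc (by fun_prop)]
    refine cfc_congr fun t ht => ?_
    have := hs t ht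
    field_simp
  have hYX' : Y * (1 + l • (S * P⁻¹ʳ * S)) = l • 1 := by
    have hXX : X * (S * P⁻¹ʳ * S) = 1 := by
      calc X * (S * P⁻¹ʳ * S) = R * (P * (R * S) * P⁻¹ʳ) * S := by rw [hX]; noncomm_ring
        _ = 1 := by rw [hRS, mul_one, hPP, mul_one, hRS]
    calc Y * (1 + l • (S * P⁻¹ʳ * S)) = Y * (X + l • 1) * (S * P⁻¹ʳ * S) := by
          rw [mul_assoc Y, add_mul, hXX, smul_mul_assoc, one_mul]
      _ = l • 1 := by rw [hYX, smul_mul_assoc, hXX]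
  have key : (S * Y * S) * (A⁻¹ʳ + l • P⁻¹ʳ) = l • 1 := by
    calc (S * Y * S) * (A⁻¹ʳ + l • P⁻¹ʳ)
        = (S * Y * S) * (R * R + l • (P⁻¹ʳ * (S * R))) := by rw [hAi, hSR, mul_one]
      _ = S * (Y * ((S * R) + l • (S * P⁻¹ʳ * S))) * R := by
          simp only [mul_add, add_mul, mul_smul_comm, smul_mul_assoc, mul_assoc]
      _ = l • 1 := by rw [hSR, hYX']; simp [hSR]
  have hu : IsUnit (A⁻¹ʳ + l • P⁻¹ʳ) :=
    (hA.ringInverse.add_nonneg (smul_nonneg hl.le hP.ringInverse.nonneg)).isUnit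
  change S * Y * S = _
  calc S * Y * S = (S * Y * S) * (A⁻¹ʳ + l • P⁻¹ʳ) * (A⁻¹ʳ + l • P⁻¹ʳ)⁻¹ʳ := by
        rw [mul_assoc _ _ (_⁻¹ʳ), Ring.mul_inverse_cancel _ hu, mul_one]
    _ = _ := by rw [key, smul_mul_assoc, one_mul]

open Ring in
theorem persp_mul_div_add_mono {A B P : H →L[ℂ] H} (hA : IsStrictlyPositive A)
    (hP : IsStrictlyPositive P) (hAB : A ≤ B) {l : ℝ} (hl : 0 < l) :
    persp (fun t => t * l / (t + l)) P A ≤ persp (fun t => t * l / (t + l)) P B := by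
  have hB := IsStrictlyPositive.of_le hA hAB
  rw [persp_mul_div_add_eq hA hP hl, persp_mul_div_add_eq hB hP hl]
  have hlP : 0 ≤ l • P⁻¹ʳ := smul_nonneg hl.le hP.ringInverse.nonneg
  refine smul_le_smul_of_nonneg_left ?_ hl.le
  exact CStarAlgebra.ringInverse_le_ringInverse
    (add_le_add_left (CStarAlgebra.ringInverse_le_ringInverse hAB hA) _)
    (hB.ringInverse.add_nonneg hlP)

theorem exists_mul_div_add_le {K : Set ℝ} (hK : IsCompact K) (hpos : ∀ t ∈ K, 0 < t) :
    ∃ C : ℝ, ∀ l > 0, ∀ t ∈ K, ‖t * l / (t + l)‖ ≤ C * (l / (1 + l)) := by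
  obtain ⟨M, hM⟩ := hK.bddAbove
  refine ⟨1 + M, fun l hl t ht => ?_⟩
  have h0 := hpos t ht
  have h1 : t ≤ M := hM ht
  rw [Real.norm_of_nonneg (by positivity), ← mul_div_assoc,
    div_le_div_iff₀ (by positivity) (by positivity)]
  have : t * (1 + l) ≤ (1 + M) * (t + l) := by nlinarith [mul_pos h0 hl]
  nlinarith

/-- The integral representation of `f` passes to its perspective. -/
theorem persp_integral_representation {f : ℝ → ℝ} {a b : ℝ} {w : Measure ℝ}
    (hw : IntegrableOn (fun l => l / (1 + l)) (Set.Ioi 0) w)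
    (hrep : ∀ t > (0 : ℝ), f t = a + b * t + ∫ l in Set.Ioi 0, t * l / (t + l) ∂w)
    {A P : H →L[ℂ] H} (hA : IsStrictlyPositive A) (hP : IsStrictlyPositive P) :
    IntegrableOn (fun l => persp (fun t => t * l / (t + l)) P A) (Set.Ioi 0) w ∧
      persp f P A = a • A + b • P +
        ∫ l in Set.Ioi 0, persp (fun t => t * l / (t + l)) P A ∂w := by
  set X := opInvSqrt A * P * opInvSqrt A
  have hXp : IsStrictlyPositive X := isStrictlyPositive_conj hA hP
  have hs := spectrum_real_pos hXp
  have hsa : IsSelfAdjoint X := hXp.nonneg.isSelfAdjoint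
  have hK : IsCompact (spectrum ℝ X) := ContinuousFunctionalCalculus.isCompact_spectrum X
  obtain ⟨C, hC⟩ := exists_mul_div_add_le hK hs
  let g : ℝ → ℝ → ℝ := fun l t => t * l / (t + l)
  have hg : ContinuousOn (Function.uncurry g) (Set.Ioi 0 ×ˢ spectrum ℝ X) := by
    refine ContinuousOn.div (by fun_prop) (by fun_prop) fun p hp => ?_
    have h1 : 0 < p.1 := hp.1
    have h2 := hs _ hp.2
    positivity
  have hbound : ∀ᵐ l ∂(w.restrict (Set.Ioi 0)), ∀ t ∈ spectrum ℝ X,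
      ‖g l t‖ ≤ C * (l / (1 + l)) :=
    ae_restrict_of_forall_mem measurableSet_Ioi hC
  have hfin : HasFiniteIntegral (fun l => C * (l / (1 + l))) (w.restrict (Set.Ioi 0)) :=
    (hw.const_mul C).hasFiniteIntegral
  have hint := integrableOn_cfc measurableSet_Ioi g _ X hg hbound hfin
  have hcfc := cfc_setIntegral measurableSet_Ioi g _ X hg hbound hfin
  let L : (H →L[ℂ] H) →L[ℝ] (H →L[ℂ] H) :=
    ContinuousLinearMap.mulLeftRight ℝ (H →L[ℂ] H) (opSqrt A) (opSqrt A)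
  have hL : ∀ T, L T = opSqrt A * T * opSqrt A := fun T => by
    simp [L]
  have hcont : ContinuousOn (fun t => ∫ l in Set.Ioi 0, g l t ∂w) (spectrum ℝ X) := by
    refine continuousOn_of_dominated (bound := fun l => C * (l / (1 + l))) ?_ ?_ (hw.const_mul C) ?_
    · intro t ht
      refine ContinuousOn.aestronglyMeasurable ?_ measurableSet_Ioi
      exact hg.comp (Continuous.prodMk_left t).continuousOn fun l hl => ⟨hl, ht⟩
    · exact fun t ht => hbound.mono fun l hl => hl t ht
    · exact ae_restrict_of_forall_mem measurableSet_Ioi fun l hl =>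
        hg.comp (Continuous.prodMk_right l).continuousOn fun t ht => ⟨hl, ht⟩
  have hf : cfc f X = a • 1 + b • X + ∫ l in Set.Ioi 0, cfc (g l) X ∂w := by
    rw [cfc_congr (g := fun t => (a + b * t) + ∫ l in Set.Ioi 0, g l t ∂w)
      fun t ht => hrep t (hs t ht), cfc_add X _ _ (by fun_prop) hcont, hcfc,
      cfc_const_add a _ X, cfc_const_mul_id b X, Algebra.algebraMap_eq_smul_one]
  have hpersp : (fun l => persp (g l) P A) = fun l => L (cfc (g l) X) :=
    funext fun l => (hL _).symm
  change IntegrableOn (fun l => persp (g l) P A) _ w ∧ _ = _ + ∫ l in Set.Ioi 0, persp (g l) P A ∂w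
  rw [hpersp]
  refine ⟨L.integrable_comp hint, ?_⟩
  rw [L.integral_comp_comm hint]
  change opSqrt A * cfc f X * opSqrt A = _
  rw [← hL, hf, map_add, map_add, map_smul, map_smul, hL 1, hL X, mul_one, opSqrt_mul_self hA,
    opSqrt_conj_cancel hA]

/-- **Theorem 2.3, (2.17).** If `f(t) = a + b t + ∫₀^∞ tλ/(t+λ) dw(λ)` on `(0,∞)` and
`B ≥ A > 0`, `P > 0`, then `𝒫_f(P,B) - 𝒫_f(P,A) ≥ a(B - A)`. -/
theorem stmt_7 (f : ℝ → ℝ) (a b : ℝ) (hb : 0 ≤ b) (w : Measure ℝ)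
    (hf : ContinuousOn f (Set.Ioi 0))
    (hw : IntegrableOn (fun l => l / (1 + l)) (Set.Ioi 0) w)
    (hrep : ∀ t > (0:ℝ), f t = a + b * t + ∫ l in Set.Ioi 0, t * l / (t + l) ∂w)
    (A B P : H →L[ℂ] H) (hA : StrictlyPos A) (hB : StrictlyPos B) (hP : StrictlyPos P)
    (hBA : (B - A).IsPositive) :
    (persp f P B - persp f P A - a • (B - A)).IsPositive := by
  have hAB : A ≤ B := hBA
  obtain ⟨hiA, hA'⟩ := persp_integral_representation hw hrep hA.isStrictlyPositive
    hP.isStrictlyPositive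
  obtain ⟨hiB, hB'⟩ := persp_integral_representation hw hrep hB.isStrictlyPositive
    hP.isStrictlyPositive
  have hmono := setIntegral_mono_on hiA hiB measurableSet_Ioi fun l hl =>
    persp_mul_div_add_mono hA.isStrictlyPositive hP.isStrictlyPositive hAB hl
  rw [hA', hB']
  have h := sub_nonneg.mpr hmono
  rw [ContinuousLinearMap.nonneg_iff_isPositive] at h
  convert h using 1
  rw [smul_sub]
  abel
end

section
/- Let f : (0,∞) → ℝ admit the representation f(t) = a + b·t + ∫₀^∞ (tλ)/(t+λ) dw(λ) for all t > 0, where a ∈ ℝ, b ≥ 0 and w is a positive measure on (0,∞) with ∫₀^∞ λ/(1+λ) dw(λ) < ∞. Then for all strictly positive operators U, V on a complex Hilbert space H, f(V) − f(U) = b(V − U) + ∫₀^∞ λ² [ (U + λ)⁻¹ − (V + λ)⁻¹ ] dw(λ), where f(U), f(V) are defined by the continuous functional calculus and U + λ abbreviates U + λ·I. -/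
open MeasureTheory

variable {H : Type*} [NormedAddCommGroup H] [InnerProductSpace ℂ H] [CompleteSpace H]

theorem div_add_le_max_mul {t l : ℝ} (ht : 0 < t) (hl : 0 < l) :
    t * l / (t + l) ≤ max t 1 * (l / (1 + l)) := by
  rw [mul_div_assoc', div_le_div_iff₀ (by positivity) (by positivity)]
  have h : t * (1 + l) ≤ max t 1 * (t + l) := by
    rcases le_total 1 t with h | h
    · rw [max_eq_left h]; nlinarith
    · rw [max_eq_right h]; nlinarith
  nlinarith [mul_le_mul_of_nonneg_right h hl.le]

theorem StrictlyPos.isSelfAdjoint {T : H →L[ℂ] H} (hT : StrictlyPos T) : IsSelfAdjoint T :=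
  hT.1.isSelfAdjoint

theorem StrictlyPos.spectrum_pos {T : H →L[ℂ] H} (hT : StrictlyPos T) {t : ℝ}
    (ht : t ∈ spectrum ℝ T) : 0 < t :=
  (IsStrictlyPositive.iff_of_unital.mpr
    ⟨(ContinuousLinearMap.nonneg_iff_isPositive T).mpr hT.1, hT.2⟩).spectrum_pos (𝕜 := ℝ) ht

theorem StrictlyPos.cfc_mul_div_add {T : H →L[ℂ] H} (hT : StrictlyPos T) {l : ℝ} (hl : 0 < l) :
    cfc (fun t : ℝ => t * l / (t + l)) T = l • 1 - l ^ 2 • Ring.inverse (T + l • 1) := by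
  have hsa := hT.isSelfAdjoint
  have hne : ∀ t ∈ spectrum ℝ T, t + l ≠ 0 := fun t ht =>
    (add_pos (hT.spectrum_pos ht) hl).ne'
  have hinv : ContinuousOn (fun t : ℝ => (t + l)⁻¹) (spectrum ℝ T) :=
    ContinuousOn.inv₀ (by fun_prop) hne
  have hcongr : cfc (fun t : ℝ => t * l / (t + l)) T
      = cfc (fun t : ℝ => l - l ^ 2 * (t + l)⁻¹) T := by
    refine cfc_congr fun t ht => ?_
    have := hne t ht
    field_simp
    ring
  rw [hcongr, cfc_sub (fun _ => l) (fun t => l ^ 2 * (t + l)⁻¹) T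
      continuousOn_const (continuousOn_const.mul hinv), cfc_const l T hsa,
    cfc_const_mul (l ^ 2) _ T hinv, cfc_inv (fun t => t + l) T hne (by fun_prop) hsa,
    cfc_add_const l (fun t => t) T continuousOn_id hsa, cfc_id' ℝ T hsa, Algebra.algebraMap_eq_smul_one]

section Representation

variable {w : Measure ℝ} {T : H →L[ℂ] H}

theorem StrictlyPos.exists_bound_mul_div_add (hT : StrictlyPos T) :
    ∃ M : ℝ, ∀ l > (0 : ℝ), ∀ t ∈ spectrum ℝ T, ‖t * l / (t + l)‖ ≤ M * (l / (1 + l)) := by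
  refine ⟨max (‖T‖ * ‖(1 : H →L[ℂ] H)‖) 1, fun l hl t ht => ?_⟩
  have ht0 := hT.spectrum_pos ht
  rw [Real.norm_of_nonneg (by positivity)]
  refine (div_add_le_max_mul ht0 hl).trans ?_
  gcongr
  exact (Real.le_norm_self t).trans (spectrum.norm_le_norm_mul_of_mem ht)

theorem StrictlyPos.continuousOn_mul_div_add (hT : StrictlyPos T) :
    ContinuousOn (Function.uncurry fun l t : ℝ => t * l / (t + l))
      (Set.Ioi 0 ×ˢ spectrum ℝ T) := by
  refine ContinuousOn.div (by fun_prop) (by fun_prop) fun p hp => ?_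
  exact (add_pos (hT.spectrum_pos hp.2) hp.1).ne'

theorem StrictlyPos.integrableOn_cfc_mul_div_add (hT : StrictlyPos T)
    (hw : IntegrableOn (fun l => l / (1 + l)) (Set.Ioi 0) w) :
    IntegrableOn (fun l : ℝ => cfc (fun t : ℝ => t * l / (t + l)) T) (Set.Ioi 0) w := by
  obtain ⟨M, hM⟩ := hT.exists_bound_mul_div_add
  exact integrableOn_cfc measurableSet_Ioi _ _ T hT.continuousOn_mul_div_add
    (ae_restrict_of_forall_mem measurableSet_Ioi hM) (hw.const_mul M).2 hT.isSelfAdjoint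

theorem StrictlyPos.cfc_eq_add_integral {f : ℝ → ℝ} {a b : ℝ} (hT : StrictlyPos T)
    (hf : ContinuousOn f (Set.Ioi 0))
    (hw : IntegrableOn (fun l => l / (1 + l)) (Set.Ioi 0) w)
    (hrep : ∀ t > (0 : ℝ), f t = a + b * t + ∫ l in Set.Ioi 0, t * l / (t + l) ∂w) :
    cfc f T = algebraMap ℝ (H →L[ℂ] H) a + b • T +
      ∫ l in Set.Ioi (0 : ℝ), cfc (fun t : ℝ => t * l / (t + l)) T ∂w := by
  have hsa := hT.isSelfAdjoint
  obtain ⟨M, hM⟩ := hT.exists_bound_mul_div_add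
  have hcont : ContinuousOn (fun t => ∫ l in Set.Ioi 0, t * l / (t + l) ∂w) (spectrum ℝ T) := by
    have hsub : ContinuousOn (fun t => f t - (a + b * t)) (spectrum ℝ T) :=
      (hf.mono fun t ht => hT.spectrum_pos ht).sub (by fun_prop)
    refine hsub.congr fun t ht => ?_
    simp [hrep t (hT.spectrum_pos ht)]
  rw [cfc_congr (f := f) (g := fun t => a + b * t + ∫ l in Set.Ioi 0, t * l / (t + l) ∂w)
      fun t ht => hrep t (hT.spectrum_pos ht),
    cfc_add T (fun t => a + b * t) _ (by fun_prop) hcont, cfc_const_add a (fun t => b * t) T,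
    cfc_const_mul_id b T, cfc_setIntegral measurableSet_Ioi (fun l t : ℝ => t * l / (t + l)) _ T
      hT.continuousOn_mul_div_add (ae_restrict_of_forall_mem measurableSet_Ioi hM)
      (hw.const_mul M).2 hsa]

end Representation

/-- **(2.2.a).** If `f(t) = a + b t + ∫₀^∞ tλ/(t+λ) dw(λ)` on `(0,∞)`, then for all
strictly positive operators `U, V`,
`f(V) - f(U) = b(V - U) + ∫₀^∞ λ² [(U + λ)⁻¹ - (V + λ)⁻¹] dw(λ)`. -/
theorem stmt_13 (f : ℝ → ℝ) (a b : ℝ) (hb : 0 ≤ b) (w : Measure ℝ)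
    (hf : ContinuousOn f (Set.Ioi 0))
    (hw : IntegrableOn (fun l => l / (1 + l)) (Set.Ioi 0) w)
    (hrep : ∀ t > (0:ℝ), f t = a + b * t + ∫ l in Set.Ioi 0, t * l / (t + l) ∂w)
    (U V : H →L[ℂ] H) (hU : StrictlyPos U) (hV : StrictlyPos V) :
    cfc f V - cfc f U = b • (V - U) +
      ∫ l in Set.Ioi (0:ℝ),
        l ^ 2 • (Ring.inverse (U + l • 1) - Ring.inverse (V + l • 1)) ∂w := by
  rw [hV.cfc_eq_add_integral hf hw hrep, hU.cfc_eq_add_integral hf hw hrep, smul_sub]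
  have hint : ∫ l in Set.Ioi (0:ℝ),
        l ^ 2 • (Ring.inverse (U + l • 1) - Ring.inverse (V + l • 1)) ∂w =
      (∫ l in Set.Ioi (0:ℝ), cfc (fun t : ℝ => t * l / (t + l)) V ∂w) -
        ∫ l in Set.Ioi (0:ℝ), cfc (fun t : ℝ => t * l / (t + l)) U ∂w := by
    rw [← integral_sub (hV.integrableOn_cfc_mul_div_add hw) (hU.integrableOn_cfc_mul_div_add hw)]
    refine setIntegral_congr_fun measurableSet_Ioi fun l hl => ?_
    simp only [hV.cfc_mul_div_add hl, hU.cfc_mul_div_add hl, smul_sub]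
    abel
  rw [hint]
  abel
end
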